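/- Every stringent skew hyperfield satisfies strong Pathetic Cancellation, and hence also Pathetic Cancellation. -/

import Mathlib

open Set

namespace PaperSHF

/-- A skew hyperfield: `F ∖ {0}` is a group under `mul`, `0` is multiplicatively
absorbing, and `add` is a commutative associative hyperaddition with neutral
element `0`, hyperinverses, reversibility, and two-sided distributivity. -/
structure SkewHyperfield (F : Type*) where
  zero : F
  one : F
  mul : F → F → F
  inv : F → F
  neg : F → F
  add : F → F → Set F
  zero_ne_one : zero ≠ one
  mul_assoc : ∀ a b c, mul (mul a b) c = mul a (mul b c)
  one_mul : ∀ a, mul one a = a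
  mul_one : ∀ a, mul a one = a
  mul_ne_zero : ∀ a b, a ≠ zero → b ≠ zero → mul a b ≠ zero
  inv_ne_zero : ∀ a, a ≠ zero → inv a ≠ zero
  mul_inv_cancel : ∀ a, a ≠ zero → mul a (inv a) = one
  inv_mul_cancel : ∀ a, a ≠ zero → mul (inv a) a = one
  zero_mul : ∀ a, mul zero a = zero
  mul_zero : ∀ a, mul a zero = zero
  add_nonempty : ∀ a b, (add a b).Nonempty
  add_comm : ∀ a b, add a b = add b a
  add_assoc : ∀ a b c, (⋃ t ∈ add b c, add a t) = (⋃ s ∈ add a b, add s c)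
  zero_add : ∀ a, add zero a = {a}
  add_neg_self : ∀ a, zero ∈ add a (neg a)
  neg_unique : ∀ a b, zero ∈ add a b → b = neg a
  reversibility : ∀ x y z, x ∈ add y z ↔ z ∈ add x (neg y)
  left_distrib : ∀ a x y, add (mul a x) (mul a y) = (fun t => mul a t) '' (add x y)
  right_distrib : ∀ a x y, add (mul x a) (mul y a) = (fun t => mul t a) '' (add x y)

/-- The hyperaddition extended to subsets: `A ⊞ B = ⋃_{a ∈ A, b ∈ B} a ⊞ b`. -/
def SkewHyperfield.sadd {F : Type*} (H : SkewHyperfield F) (A B : Set F) : Set F :=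
  ⋃ a ∈ A, ⋃ b ∈ B, H.add a b

/-- Strong Pathetic Cancellation. -/
def StrongPatheticCancellation {F : Type*} (H : SkewHyperfield F) : Prop :=
  ∀ a b x y : F, a ≠ H.zero → b ≠ H.zero → x ≠ H.zero → y ≠ H.zero →
    x ∈ H.add H.one a → y ∈ H.add (H.neg H.one) b →
    H.add x y ∩ H.add a b ⊆ H.add (H.mul x b) (H.neg (H.mul a y))

/-- Pathetic Cancellation. -/
def PatheticCancellation {F : Type*} (H : SkewHyperfield F) : Prop :=
  ∀ a b x y z : F, a ≠ H.zero → b ≠ H.zero → x ≠ H.zero → y ≠ H.zero → z ≠ H.zero →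
    x ∈ H.add H.one a → H.mul a x = H.mul x a →
    y ∈ H.add (H.neg H.one) b → H.mul b y = H.mul y b →
    z ∈ H.add a b →
    H.mul (H.mul (H.inv a) z) (H.inv b) = H.mul (H.mul (H.inv b) z) (H.inv a) →
    z ∈ H.add x y →
    H.mul (H.mul (H.inv x) z) (H.inv y) = H.mul (H.mul (H.inv y) z) (H.inv x) →
    z ∈ H.add (H.mul x b) (H.neg (H.mul a y))


/-- A skew hyperfield is stringent if `a ⊞ b` is a singleton whenever `a ≠ -b`. -/
def Stringent {F : Type*} (H : SkewHyperfield F) : Prop :=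
  ∀ a b : F, a ≠ H.neg b → ∃ c, H.add a b = {c}


namespace SkewHyperfield

variable {F : Type*} (H : SkewHyperfield F)

theorem mul_neg_eq (a b : F) : H.mul a (H.neg b) = H.neg (H.mul a b) := by
  refine H.neg_unique _ _ ?_
  rw [H.left_distrib]
  exact ⟨H.zero, H.add_neg_self b, H.mul_zero a⟩

theorem neg_mul_eq (a b : F) : H.mul (H.neg a) b = H.neg (H.mul a b) := by
  refine H.neg_unique _ _ ?_
  rw [H.right_distrib]
  exact ⟨H.zero, H.add_neg_self a, H.zero_mul b⟩

theorem neg_neg_eq (a : F) : H.neg (H.neg a) = a :=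
  (H.neg_unique _ _ (H.add_comm a (H.neg a) ▸ H.add_neg_self a)).symm

theorem mul_mem_left (c : F) {x a b : F} (h : x ∈ H.add a b) :
    H.mul c x ∈ H.add (H.mul c a) (H.mul c b) := by
  rw [H.left_distrib]
  exact ⟨x, h, rfl⟩

theorem mul_mem_right (c : F) {x a b : F} (h : x ∈ H.add a b) :
    H.mul x c ∈ H.add (H.mul a c) (H.mul b c) := by
  rw [H.right_distrib]
  exact ⟨x, h, rfl⟩

theorem exists_mem_add_of_mem_add {a b c t u : F} (hu : u ∈ H.add a t) (ht : t ∈ H.add b c) :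
    ∃ s ∈ H.add a b, u ∈ H.add s c := by
  have h : u ∈ ⋃ t ∈ H.add b c, H.add a t := mem_biUnion ht hu
  rw [H.add_assoc] at h
  simpa using h

end SkewHyperfield

theorem Stringent.eq_of_mem {F : Type*} {H : SkewHyperfield F} (hstr : Stringent H)
    {a b c d : F} (hab : a ≠ H.neg b) (hc : c ∈ H.add a b) (hd : d ∈ H.add a b) : c = d := by
  obtain ⟨e, he⟩ := hstr a b hab
  rw [he] at hc hd
  exact hc.trans hd.symm

theorem Stringent.strongPatheticCancellation {F : Type*} {H : SkewHyperfield F}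
    (hstr : Stringent H) : StrongPatheticCancellation H := by
  rintro a b x y - - - - hx hy z ⟨hzxy, hzab⟩
  by_cases ha : H.one = H.neg a
  · by_cases hb : H.neg H.one = H.neg b
    · have hb' : b = H.one := by rw [← H.neg_neg_eq b, ← hb, H.neg_neg_eq]
      rwa [hb', H.mul_one, ← H.neg_mul_eq, ← ha, H.one_mul]
    · have h₁ : H.one ∈ H.add (H.neg a) x := by
        rw [H.add_comm]
        exact (H.reversibility _ _ _).1 (H.add_comm _ _ ▸ hx)
      have h₂ := H.mul_mem_right b h₁
      rw [H.one_mul] at h₂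
      obtain ⟨s, hs, hz⟩ := H.exists_mem_add_of_mem_add hzab h₂
      have e : H.mul (H.neg a) (H.neg H.one) = a := by
        rw [H.mul_neg_eq, H.mul_one, H.neg_neg_eq]
      have hsum := H.left_distrib (H.neg a) (H.neg H.one) b
      rw [e] at hsum
      rw [hsum] at hs
      obtain ⟨t, ht, rfl⟩ := hs
      simpa only [hstr.eq_of_mem hb ht hy, H.neg_mul_eq, H.add_comm] using hz
  · have h₁ : H.one ∈ H.add b (H.neg y) := by
      have h := (H.reversibility _ _ _).1 hy
      rw [H.neg_neg_eq] at h
      exact (H.reversibility _ _ _).1 h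
    have h₂ := H.mul_mem_left a h₁
    rw [H.mul_one, H.mul_neg_eq] at h₂
    obtain ⟨s, hs, hz⟩ := H.exists_mem_add_of_mem_add (H.add_comm _ _ ▸ hzab) h₂
    have hsum := H.right_distrib b H.one a
    rw [H.one_mul] at hsum
    rw [hsum] at hs
    obtain ⟨t, ht, rfl⟩ := hs
    rwa [hstr.eq_of_mem ha ht hx] at hz

theorem StrongPatheticCancellation.patheticCancellation {F : Type*} {H : SkewHyperfield F}
    (h : StrongPatheticCancellation H) : PatheticCancellation H :=
  fun a b x y _ ha hb hx hy _ hxa _ hyb _ hzab _ hzxy _ =>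
    h a b x y ha hb hx hy hxa hyb ⟨hzxy, hzab⟩

/-- every stringent skew hyperfield satisfies strong Pathetic
Cancellation, hence also Pathetic Cancellation. -/
theorem stringent_implies_PC {F : Type*} (H : SkewHyperfield F)
    (hstr : Stringent H) :
    StrongPatheticCancellation H ∧ PatheticCancellation H :=
  ⟨hstr.strongPatheticCancellation, hstr.strongPatheticCancellation.patheticCancellation⟩

end PaperSHF
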